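/- There exist absolute constants C, C' > 0 with the following property. Let ε ∈ (0, 1/2), let β ≥ C/ε³, let γ > 0, and let G = (V,E) be a finite simple graph on n vertices with average degree d = 2|E|/n. Let H ⊆ E be an EDBS of G with parameter β (deg_H(e) ≤ β for every e ∈ H) and let U = {e ∈ E ∖ H : deg_H(e) < (1−ε)·β}. Let V* = {v ∈ V : deg_E(v) ≤ d/ε}, let E* be the set of edges of E with both endpoints in V*, let H* = H ∩ E* and U* = U ∩ E*, and assume |U*| ≤ n·d^γ. Let V*_small ⊆ V* be any set containing every vertex v ∈ V* with deg_{U*}(v) ≤ (1−ε)·d^γ/ε, and let E*_small = {e ∈ H* ∪ U* : both endpoints of e lie in V*_small}. Then μ(G) ≤ (3/2 + ε)·μ(E*_small) + C'·ε·n. -/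

import Mathlib

open Finset
open scoped Classical

/-- The degree of a vertex `v` in an edge set `H`: the number of edges of `H` incident to `v`. -/
noncomputable def degV {V : Type*} (H : Finset (Sym2 V)) (v : V) : ℕ :=
  (H.filter (fun e => v ∈ e)).card

/-- The edge degree of an unordered pair `e = {u,w}` in an edge set `H`:
`deg_H(u) + deg_H(w)`. -/
noncomputable def degE {V : Type*} (H : Finset (Sym2 V)) (e : Sym2 V) : ℕ :=
  Sym2.lift ⟨fun u w => degV H u + degV H w, fun _ _ => add_comm _ _⟩ e

/-- `M` is a matching: its edges are non-loops and pairwise vertex-disjoint. -/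
def IsMatching {V : Type*} (M : Finset (Sym2 V)) : Prop :=
  (∀ e ∈ M, ¬ e.IsDiag) ∧ ∀ e ∈ M, ∀ f ∈ M, e ≠ f → ∀ v : V, v ∈ e → v ∉ f

/-- `matchNum F` = μ(F), the maximum size of a matching contained in the edge set `F`. -/
noncomputable def matchNum {V : Type*} (F : Finset (Sym2 V)) : ℕ :=
  F.powerset.sup (fun M => if IsMatching M then M.card else 0)

universe u

/-! ### Degrees and matching numbers of edge sets -/

theorem card_filter_mem_of_not_isDiag {V : Type*} [Fintype V] {e : Sym2 V} (he : ¬ e.IsDiag) :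
    (univ.filter (fun v => v ∈ e)).card = 2 := by
  induction e with
  | h a b =>
    have hab : a ≠ b := by simpa using he
    have : univ.filter (fun v => v ∈ s(a, b)) = {a, b} := by
      ext v; simp
    rw [this, card_pair hab]

theorem sum_degV {V : Type*} [Fintype V] {F : Finset (Sym2 V)} (hF : ∀ e ∈ F, ¬ e.IsDiag) :
    ∑ v, degV F v = 2 * F.card := by
  have h := sum_card_bipartiteAbove_eq_sum_card_bipartiteBelow
    (s := (univ : Finset V)) (t := F) (fun v e => v ∈ e)
  unfold bipartiteAbove bipartiteBelow at h
  simp only [degV]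
  rw [h, sum_congr rfl (fun e he => card_filter_mem_of_not_isDiag (hF e he)), sum_const,
    smul_eq_mul, mul_comm]

theorem degV_eq_card_neighbors {V : Type*} [Fintype V] (F : Finset (Sym2 V)) (v : V) :
    degV F v = (univ.filter (fun w => s(v, w) ∈ F)).card := by
  symm
  unfold degV
  refine card_bij (fun w _ => s(v, w)) ?_ ?_ ?_
  · intro w hw
    simpa using hw
  · intro w _ w' _ h
    exact Sym2.congr_right.1 h
  · intro e he
    obtain ⟨heF, w, rfl⟩ := mem_filter.1 he
    exact ⟨w, by simpa using heF, rfl⟩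

theorem IsMatching.card_le_matchNum {V : Type*} {M F : Finset (Sym2 V)} (hM : IsMatching M)
    (h : M ⊆ F) : M.card ≤ matchNum F := by
  have := le_sup (f := fun M : Finset (Sym2 V) => if IsMatching M then M.card else 0)
    (mem_powerset.2 h)
  simpa [hM, matchNum] using this

theorem exists_isMatching_card_eq_matchNum {V : Type*} (F : Finset (Sym2 V)) :
    ∃ M ⊆ F, IsMatching M ∧ M.card = matchNum F := by
  obtain ⟨M, hM, h⟩ := exists_mem_eq_sup F.powerset ⟨∅, by simp⟩
    (fun M : Finset (Sym2 V) => if IsMatching M then M.card else 0)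
  by_cases hm : IsMatching M
  · exact ⟨M, mem_powerset.1 hM, hm, by simp [matchNum, h, hm]⟩
  · refine ⟨∅, by simp, ⟨by simp, by simp⟩, ?_⟩
    simp [matchNum, h, hm]

theorem IsMatching.degV_le_one {V : Type*} {M : Finset (Sym2 V)} (hM : IsMatching M) (v : V) :
    degV M v ≤ 1 := by
  unfold degV
  refine card_le_one.2 fun e he f hf => ?_
  simp only [mem_filter] at he hf
  by_contra hne
  exact hM.2 e he.1 f hf.1 hne v he.2 hf.2

/-- Deleting the vertices in `B` lowers the matching number by at most `B.card`. -/
theorem matchNum_le_matchNum_add_card {V : Type*} {F F' : Finset (Sym2 V)} {B : Finset V}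
    (h : ∀ e ∈ F, (∀ v ∈ e, v ∉ B) → e ∈ F') : matchNum F ≤ matchNum F' + B.card := by
  obtain ⟨M, hMF, hM, hc⟩ := exists_isMatching_card_eq_matchNum F
  have h1 : (M.filter (fun e => ∀ v ∈ e, v ∉ B)).card ≤ matchNum F' := by
    refine IsMatching.card_le_matchNum ⟨?_, ?_⟩ fun e he => ?_
    · exact fun e he => hM.1 e (mem_filter.1 he).1
    · exact fun e he f hf => hM.2 e (mem_filter.1 he).1 f (mem_filter.1 hf).1
    · exact h e (hMF (mem_filter.1 he).1) (mem_filter.1 he).2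
  have h2 : (M.filter (fun e => ¬ ∀ v ∈ e, v ∉ B)).card ≤ B.card := by
    have hsub : M.filter (fun e => ¬ ∀ v ∈ e, v ∉ B)
        ⊆ B.biUnion (fun v => M.filter (fun e => v ∈ e)) := by
      intro e he
      simp only [mem_filter, not_forall, not_not, mem_biUnion] at he ⊢
      obtain ⟨heM, v, hve, hvB⟩ := he
      exact ⟨v, hvB, heM, hve⟩
    calc _ ≤ _ := card_le_card hsub
      _ ≤ B.card * 1 := card_biUnion_le_card_mul _ _ _ (fun v _ => hM.degV_le_one v)
      _ = B.card := mul_one _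
  have h3 := card_filter_add_card_filter_not (s := M) (fun e => ∀ v ∈ e, v ∉ B)
  omega

/-- An involution pairing vertices along edges of `F` yields a matching in `F`. -/
theorem card_ne_le_two_mul_matchNum {V : Type*} [Fintype V] {F : Finset (Sym2 V)} {p : V → V}
    (hp : ∀ v, p (p v) = v) (hF : ∀ v, p v ≠ v → s(v, p v) ∈ F) :
    (univ.filter (fun v => p v ≠ v)).card ≤ 2 * matchNum F := by
  set N := univ.filter (fun v => p v ≠ v) with hN
  set M := N.image (fun v => s(v, p v)) with hMdef
  have hM : IsMatching M := by
    constructor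
    · intro e he
      obtain ⟨v, hv, rfl⟩ := mem_image.1 he
      simpa [hN, eq_comm] using hv
    · intro e he f hf hne w hwe hwf
      obtain ⟨v, hv, rfl⟩ := mem_image.1 he
      obtain ⟨v', hv', rfl⟩ := mem_image.1 hf
      have key : ∀ x, w ∈ s(x, p x) → s(x, p x) = s(w, p w) := by
        intro x hx
        rcases Sym2.mem_iff.1 hx with rfl | rfl
        · rfl
        · rw [hp, Sym2.eq_swap]
      exact hne ((key v hwe).trans (key v' hwf).symm)
  have hMF : M ⊆ F := by
    intro e he
    obtain ⟨v, hv, rfl⟩ := mem_image.1 he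
    exact hF v (mem_filter.1 hv).2
  have hcard : N.card ≤ 2 * M.card := by
    refine card_le_mul_card_image N 2 fun e he => ?_
    obtain ⟨v, hv, rfl⟩ := mem_image.1 he
    have : N.filter (fun x => s(x, p x) = s(v, p v)) ⊆ {v, p v} := by
      intro x hx
      have h2 := (mem_filter.1 hx).2
      have : x ∈ s(v, p v) := h2 ▸ Sym2.mem_mk_left x (p x)
      simpa using this
    exact (card_le_card this).trans card_le_two
  have := hM.card_le_matchNum hMF
  omega

/-- A matching is given by the involution exchanging the endpoints of its edges. -/
theorem IsMatching.exists_involution {V : Type*} [Fintype V] {M : Finset (Sym2 V)}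
    (hM : IsMatching M) :
    ∃ p : V → V, (∀ v, p (p v) = v) ∧ (∀ v, p v ≠ v → s(v, p v) ∈ M) ∧
      2 * M.card ≤ (univ.filter (fun v => p v ≠ v)).card := by
  have huniq : ∀ v w w', s(v, w) ∈ M → s(v, w') ∈ M → w = w' := by
    intro v w w' h h'
    by_contra hne
    exact hM.2 _ h _ h' (mt Sym2.congr_right.1 hne) v (by simp) (by simp)
  let p : V → V := fun v => if h : ∃ w, s(v, w) ∈ M then h.choose else v
  have hp : ∀ v w, s(v, w) ∈ M → p v = w := by
    intro v w h
    have hex : ∃ w, s(v, w) ∈ M := ⟨w, h⟩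
    simp only [p, dif_pos hex]
    exact huniq v _ _ hex.choose_spec h
  have hp' : ∀ v, (∀ w, s(v, w) ∉ M) → p v = v := by
    intro v h
    simp [p, h]
  refine ⟨p, ?_, ?_, ?_⟩
  · intro v
    by_cases h : ∃ w, s(v, w) ∈ M
    · obtain ⟨w, hw⟩ := h
      rw [hp v w hw, hp w v (Sym2.eq_swap ▸ hw)]
    · push Not at h
      rw [hp' v h, hp' v h]
  · intro v hv
    by_contra h
    refine hv (hp' v fun w hw => h ?_)
    rwa [hp v w hw]
  · rw [← sum_degV hM.1, card_filter]
    refine sum_le_sum fun v _ => ?_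
    split_ifs with h
    · exact hM.degV_le_one v
    · simp only [nonpos_iff_eq_zero]
      rw [degV, card_eq_zero, filter_eq_empty_iff]
      rintro e he ⟨w, rfl⟩
      refine h fun hv => hM.1 _ he ?_
      rw [hp v w he] at hv
      simp [hv]

/-! ### Labelled components and the Tutte–Berge formula -/

/-- The vertices outside `A` with label `i`. -/
noncomputable def labelClass {V ι : Type*} [Fintype V] (A : Finset V) (c : V → ι) (i : ι) :
    Finset V :=
  univ.filter (fun v => v ∉ A ∧ c v = i)

/-- The labels whose class outside `A` has odd cardinality. -/
noncomputable def oddLabels {V ι : Type*} [Fintype V] (A : Finset V) (c : V → ι) : Finset ι :=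
  (univ.image c).filter (fun i => Odd (labelClass A c i).card)

theorem mem_labelClass {V ι : Type*} [Fintype V] {A : Finset V} {c : V → ι} {i : ι} {v : V} :
    v ∈ labelClass A c i ↔ v ∉ A ∧ c v = i := by
  simp [labelClass]

theorem mem_oddLabels {V ι : Type*} [Fintype V] {A : Finset V} {c : V → ι} {i : ι} :
    i ∈ oddLabels A c ↔ Odd (labelClass A c i).card := by
  simp only [oddLabels, mem_filter, mem_image, mem_univ, true_and, and_iff_right_iff_imp]
  intro h
  obtain ⟨v, hv⟩ := card_pos.1 h.pos
  exact ⟨v, (mem_labelClass.1 hv).2⟩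

theorem odd_card_oddLabels_iff {V ι : Type*} [Fintype V] (A : Finset V) (c : V → ι) :
    Odd (oddLabels A c).card ↔ Odd (univ \ A).card := by
  have h : (univ \ A).card = ∑ i ∈ univ.image c, (labelClass A c i).card := by
    rw [card_eq_sum_card_fiberwise (f := c) (t := univ.image c) (by intro v; simp)]
    refine sum_congr rfl fun i _ => congrArg card ?_
    ext v
    simp [mem_labelClass]
  rw [h, odd_sum_iff_odd_card_odd, oddLabels]

/-- A labelled form of the nontrivial direction of Tutte's theorem. -/
theorem exists_labels_of_forall_not_isPerfectMatching {W : Type u} [Fintype W]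
    (G : SimpleGraph W) (heven : Even (Fintype.card W))
    (h : ∀ M : G.Subgraph, ¬ M.IsPerfectMatching) :
    ∃ (A : Finset W) (ι : Type u) (c : W → ι),
      (∀ v w, v ∉ A → w ∉ A → G.Adj v w → c v = c w) ∧
      A.card + 2 ≤ (oddLabels A c).card := by
  obtain ⟨u, hu⟩ : ∃ u, G.IsTutteViolator u := by
    by_contra hcon
    push Not at hcon
    obtain ⟨M, hM⟩ := SimpleGraph.tutte.2 hcon
    exact h M hM
  set K := ((⊤ : G.Subgraph).deleteVerts u) with hK
  have hmem : ∀ w, w ∉ u.toFinset → w ∈ K.verts := by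
    intro w hw
    simpa [hK] using hw
  let c : W → Option K.coe.ConnectedComponent := fun w =>
    if hw : w ∈ K.verts then some (K.coe.connectedComponentMk ⟨w, hw⟩) else none
  have hc : ∀ w (hw : w ∈ K.verts), c w = some (K.coe.connectedComponentMk ⟨w, hw⟩) := by
    intro w hw
    simp [c, hw]
  refine ⟨u.toFinset, _, c, ?_, ?_⟩
  · intro v w hv hw hvw
    rw [hc v (hmem v hv), hc w (hmem w hw), Option.some_inj]
    refine SimpleGraph.ConnectedComponent.connectedComponentMk_eq_of_adj ?_
    have hv' : v ∉ u := by simpa using hv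
    have hw' : w ∉ u := by simpa using hw
    simp [hK, hv', hw', hvw]
  · have hle : K.coe.oddComponents.ncard ≤ (oddLabels u.toFinset c).card := by
      rw [← Set.ncard_coe_finset]
      refine Set.ncard_le_ncard_of_injOn some ?_ (Option.some_injective _).injOn (Set.toFinite _)
      intro C hC
      rw [mem_coe, mem_oddLabels]
      have : (labelClass u.toFinset c (some C)).card = C.supp.ncard := by
        rw [← Set.ncard_coe_finset, ← Set.ncard_image_of_injective _ Subtype.val_injective]
        congr 1
        ext w
        simp only [mem_coe, mem_labelClass, Set.mem_image,
          SimpleGraph.ConnectedComponent.mem_supp_iff, Subtype.exists, exists_and_right, exists_eq_right]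
        constructor
        · rintro ⟨hw, hcw⟩
          refine ⟨hmem w hw, ?_⟩
          rwa [hc w (hmem w hw), Option.some_inj] at hcw
        · rintro ⟨hw, hcw⟩
          refine ⟨by simpa [hK] using hw, ?_⟩
          rw [hc w hw, hcw]
      rw [this]
      exact hC
    have hlt : u.toFinset.card < (oddLabels u.toFinset c).card := by
      rw [← Set.ncard_eq_toFinset_card']
      exact lt_of_lt_of_le hu hle
    have hpar := odd_card_oddLabels_iff u.toFinset c
    have hsum := card_sdiff_add_card_eq_card (subset_univ u.toFinset)
    rw [card_univ] at hsum
    rw [Nat.odd_iff, Nat.odd_iff] at hpar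
    rw [Nat.even_iff] at heven
    omega

/-- The graph obtained from `(V, F)` by joining `q` new vertices to each other and to `V`. -/
def joinGraph {V : Type*} (F : Finset (Sym2 V)) (q : ℕ) : SimpleGraph (V ⊕ Fin q) where
  Adj
    | .inl v, .inl w => v ≠ w ∧ s(v, w) ∈ F
    | x, y => x ≠ y
  symm := ⟨by
    rintro (v | i) (w | j) h
    · exact ⟨h.1.symm, Sym2.eq_swap ▸ h.2⟩
    all_goals exact Ne.symm h⟩
  loopless := ⟨by rintro (v | i) h <;> simp at h⟩

theorem card_le_of_joinGraph_isPerfectMatching {V : Type*} [Fintype V] {F : Finset (Sym2 V)}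
    {q : ℕ} {M : (joinGraph F q).Subgraph} (hM : M.IsPerfectMatching) :
    Fintype.card V ≤ 2 * matchNum F + q := by
  rw [SimpleGraph.Subgraph.isPerfectMatching_iff] at hM
  choose f hf hf' using hM
  have hff : ∀ x, f (f x) = x := fun x => (hf' (f x) x (hf x).symm).symm
  let p : V → V := fun v => Sum.elim id (fun _ => v) (f (.inl v))
  have hpl : ∀ v w, f (.inl v) = .inl w → p v = w := fun v w h => by simp [p, h]
  have hpr : ∀ v i, f (.inl v) = .inr i → p v = v := fun v i h => by simp [p, h]
  have hadj : ∀ v w, f (.inl v) = .inl w → v ≠ w ∧ s(v, w) ∈ F := by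
    intro v w h
    have := M.adj_sub (hf (.inl v))
    rw [h] at this
    exact this
  have hpp : ∀ v, p (p v) = v := by
    intro v
    rcases h : f (.inl v) with w | i
    · rw [hpl v w h]
      refine hpl w v ?_
      rw [← h, hff]
    · rw [hpr v i h, hpr v i h]
  have h1 := card_ne_le_two_mul_matchNum (F := F) hpp (by
    intro v hv
    rcases h : f (.inl v) with w | i
    · rw [hpl v w h]
      exact (hadj v w h).2
    · exact absurd (hpr v i h) hv)
  have h2 : (univ.filter (fun v => ¬ p v ≠ v)).card ≤ q := by
    have hex : ∀ v, ¬ p v ≠ v → ∃ i, f (.inl v) = .inr i := by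
      intro v hv
      rcases h : f (.inl v) with w | i
      · refine absurd ?_ hv
        rw [hpl v w h]
        exact (hadj v w h).1.symm
      · exact ⟨i, rfl⟩
    have : (univ.filter (fun v => ¬ p v ≠ v)).card
        ≤ ((univ : Finset (Fin q)).image (Sum.inr : Fin q → V ⊕ Fin q)).card := by
      refine card_le_card_of_injOn (fun v => f (.inl v)) ?_ ?_
      · intro v hv
        obtain ⟨i, hi⟩ := hex v (mem_filter.1 hv).2
        simp [hi]
      · intro v _ w _ h
        have := congrArg f h
        simpa [hff] using this
    exact this.trans (card_image_le.trans (by simp))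
  have h3 := card_filter_add_card_filter_not (s := (univ : Finset V)) (fun v => p v ≠ v)
  rw [card_univ] at h3
  omega

/-- The nontrivial inequality of the Tutte–Berge formula. -/
theorem exists_labels_card_add_card_le {V : Type u} [Fintype V] (F : Finset (Sym2 V)) :
    ∃ (A : Finset V) (ι : Type u) (c : V → ι),
      (∀ v w, v ∉ A → w ∉ A → s(v, w) ∈ F → c v = c w) ∧
      Fintype.card V + A.card ≤ 2 * matchNum F + (oddLabels A c).card := by
  by_cases hn : Fintype.card V ≤ 2 * matchNum F + 1
  · refine ⟨∅, PUnit, fun _ => PUnit.unit, fun _ _ _ _ _ => rfl, ?_⟩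
    have := odd_card_oddLabels_iff (∅ : Finset V) (fun _ => PUnit.unit.{u + 1})
    rw [sdiff_empty, card_univ, Nat.odd_iff, Nat.odd_iff] at this
    rw [card_empty]
    omega
  · obtain ⟨q, hq⟩ : ∃ q, Fintype.card V = 2 * matchNum F + q + 2 :=
      ⟨Fintype.card V - 2 * matchNum F - 2, by omega⟩
    obtain ⟨A', ι, c, hadj, hodd⟩ := exists_labels_of_forall_not_isPerfectMatching
      (joinGraph F q) (by
        rw [Fintype.card_sum, Fintype.card_fin, hq]
        exact ⟨matchNum F + q + 1, by ring⟩)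
      (fun M hM => by
        have := card_le_of_joinGraph_isPerfectMatching hM
        omega)
    have hinr : ∀ j : Fin q, (Sum.inr j : V ⊕ Fin q) ∈ A' := by
      intro j
      by_contra hj
      have hconst : ∀ x, x ∉ A' → c x = c (.inr j) := by
        intro x hx
        by_cases hxj : x = .inr j
        · rw [hxj]
        · refine hadj x _ hx hj ?_
          cases x <;> exact hxj
      have : oddLabels A' c ⊆ {c (.inr j)} := by
        intro i hi
        obtain ⟨x, hx⟩ := card_pos.1 (mem_oddLabels.1 hi).pos
        obtain ⟨hxA, rfl⟩ := mem_labelClass.1 hx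
        rw [mem_singleton]
        exact hconst x hxA
      have := card_le_card this
      rw [card_singleton] at this
      omega
    set A := univ.filter (fun v : V => (Sum.inl v : V ⊕ Fin q) ∈ A') with hA
    have hA' : A' = A.disjSum univ := by
      ext x
      rcases x with v | j
      · simp [hA]
      · simp [hinr]
    have hcls : ∀ i, (labelClass A (fun v => c (.inl v)) i).card = (labelClass A' c i).card := by
      intro i
      rw [← card_map Function.Embedding.inl]
      congr 1
      ext x
      rcases x with v | j
      · simp [mem_labelClass, hA]
      · simp [mem_labelClass, hinr]
    have hlab : oddLabels A (fun v => c (.inl v)) = oddLabels A' c := by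
      ext i
      rw [mem_oddLabels, mem_oddLabels, hcls]
    refine ⟨A, ι, fun v => c (.inl v), ?_, ?_⟩
    · intro v w hv hw hvw
      by_cases hne : v = w
      · rw [hne]
      · exact hadj (.inl v) (.inl w) (by simpa [hA] using hv) (by simpa [hA] using hw) ⟨hne, hvw⟩
    · rw [hlab]
      rw [hA', card_disjSum, card_univ, Fintype.card_fin, ← hA'] at hodd
      omega

/-! ### Edge-degree-bounded subgraphs and matchings -/

theorem card_neighbors_le_degV {V : Type*} [Fintype V] (H : Finset (Sym2 V)) (v : V)
    (T : Finset V) : (T.filter (fun t => s(v, t) ∈ H)).card ≤ degV H v := by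
  rw [degV_eq_card_neighbors]
  exact card_le_card (filter_subset_filter _ (subset_univ T))

/-- In an edge-degree-bounded subgraph, a set `S` of paired vertices with large total edge degree,
nearly all of whose edges go to `T`, is essentially no larger than `T`. -/
theorem card_le_card_add_of_degE_le {V : Type*} [Fintype V] {H : Finset (Sym2 V)} {ε β : ℝ}
    (hε : 0 < ε) (hε' : ε < 1 / 2) (hβ : 2 / ε ^ 2 ≤ β) (hH : ∀ e ∈ H, (degE H e : ℝ) ≤ β)
    {S T : Finset V} {p : V → V} (hpS : ∀ s ∈ S, p s ∈ S) (hp : ∀ s, p (p s) = s)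
    (hdeg : ∀ s ∈ S, (1 - ε) * β ≤ degV H s + degV H (p s))
    (hnbr : ∀ s ∈ S, (degV H s : ℝ) ≤ (T.filter (fun t => s(s, t) ∈ H)).card + 1 / ε) :
    (S.card : ℝ) ≤ T.card + 2 * ε * (S.card + T.card) := by
  set dS : V → ℝ := fun s => ((T.filter (fun t => s(s, t) ∈ H)).card : ℝ) with hdS
  set dT : V → ℝ := fun t => ((S.filter (fun s => s(s, t) ∈ H)).card : ℝ) with hdT
  set m : ℝ := ∑ s ∈ S, dS s with hm
  have hβpos : 0 < β := lt_of_lt_of_le (by positivity) hβ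
  have hmT : m = ∑ t ∈ T, dT t := by
    have := sum_card_bipartiteAbove_eq_sum_card_bipartiteBelow (s := S) (t := T)
      (fun s t => s(s, t) ∈ H)
    simp only [bipartiteAbove, bipartiteBelow] at this
    simp only [hm, hdS, hdT]
    exact_mod_cast this
  have hlow : S.card * ((1 - 2 * ε) * β / 2) ≤ m := by
    have h1 : ∑ s ∈ S, (degV H (p s) : ℝ) = ∑ s ∈ S, (degV H s : ℝ) :=
      sum_nbij' p p hpS hpS (fun s _ => hp s) (fun s _ => hp s) (fun s _ => rfl)
    have h2 : S.card * ((1 - ε) * β) ≤ 2 * ∑ s ∈ S, (degV H s : ℝ) := by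
      calc _ = ∑ s ∈ S, (1 - ε) * β := by simp
        _ ≤ ∑ s ∈ S, ((degV H s : ℝ) + degV H (p s)) := sum_le_sum hdeg
        _ = _ := by rw [sum_add_distrib, h1]; ring
    have h3 : ∑ s ∈ S, (degV H s : ℝ) ≤ m + S.card * (1 / ε) := by
      calc _ ≤ ∑ s ∈ S, (dS s + 1 / ε) := sum_le_sum hnbr
        _ = _ := by rw [sum_add_distrib]; simp [hm]
    have h4 : 1 / ε ≤ ε * β / 2 := by
      have : ε / 2 * (2 / ε ^ 2) ≤ ε / 2 * β := by gcongr
      calc 1 / ε = ε / 2 * (2 / ε ^ 2) := by field_simp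
        _ ≤ _ := by linarith
    have h5 : S.card * (1 / ε) ≤ S.card * (ε * β / 2) := by gcongr
    linarith
  have hup : ∑ s ∈ S, dS s ^ 2 + ∑ t ∈ T, dT t ^ 2 ≤ β * m := by
    have e1 : ∑ s ∈ S, dS s ^ 2 = ∑ s ∈ S, ∑ t ∈ T, if s(s, t) ∈ H then dS s else 0 := by
      refine sum_congr rfl fun s _ => ?_
      rw [← sum_filter, sum_const, nsmul_eq_mul, sq]
    have e2 : ∑ t ∈ T, dT t ^ 2 = ∑ s ∈ S, ∑ t ∈ T, if s(s, t) ∈ H then dT t else 0 := by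
      rw [sum_comm]
      refine sum_congr rfl fun t _ => ?_
      rw [← sum_filter, sum_const, nsmul_eq_mul, sq]
    have e3 : β * m = ∑ s ∈ S, ∑ t ∈ T, if s(s, t) ∈ H then β else 0 := by
      rw [hm, mul_sum]
      refine sum_congr rfl fun s _ => ?_
      rw [← sum_filter, sum_const, nsmul_eq_mul, mul_comm]
    rw [e1, e2, e3, ← sum_add_distrib]
    refine sum_le_sum fun s _ => ?_
    rw [← sum_add_distrib]
    refine sum_le_sum fun t _ => ?_
    split_ifs with h
    · have h1 : dS s ≤ degV H s := by exact Nat.cast_le.2 (card_neighbors_le_degV H s T)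
      have h2 : dT t ≤ degV H t := by
        simp only [hdT, Sym2.eq_swap (b := t)]
        exact Nat.cast_le.2 (card_neighbors_le_degV H t S)
      have h3 : ((degV H s + degV H t : ℕ) : ℝ) ≤ β := hH _ h
      push_cast at h3
      linarith
    · simp
  have hcs1 : m ^ 2 ≤ S.card * ∑ s ∈ S, dS s ^ 2 := sq_sum_le_card_mul_sum_sq
  have hcs2 : m ^ 2 ≤ T.card * ∑ t ∈ T, dT t ^ 2 := by
    rw [hmT]
    exact sq_sum_le_card_mul_sum_sq
  have hs0 : (0 : ℝ) ≤ S.card := by positivity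
  have ht0 : (0 : ℝ) ≤ T.card := by positivity
  rcases hs0.eq_or_lt with hs | hs
  · rw [← hs]
    positivity
  have hmpos : 0 < m := lt_of_lt_of_le (by
    have : 0 < 1 - 2 * ε := by linarith
    positivity) hlow
  have hm2 : m * (S.card + T.card) ≤ S.card * T.card * β := by
    have h1 : (T.card : ℝ) * m ^ 2 ≤ T.card * (S.card * ∑ s ∈ S, dS s ^ 2) := by gcongr
    have h2 : (S.card : ℝ) * m ^ 2 ≤ S.card * (T.card * ∑ t ∈ T, dT t ^ 2) := by gcongr
    have h3 : (S.card : ℝ) * T.card * (∑ s ∈ S, dS s ^ 2 + ∑ t ∈ T, dT t ^ 2)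
        ≤ S.card * T.card * (β * m) := by gcongr
    refine le_of_mul_le_mul_left ?_ hmpos
    linarith
  have hfin : (S.card * β / 2) * ((1 - 2 * ε) * (S.card + T.card))
      ≤ (S.card * β / 2) * (2 * T.card) := by
    have := mul_le_mul_of_nonneg_right hlow (add_nonneg hs0 ht0)
    linarith
  have := le_of_mul_le_mul_left hfin (by positivity)
  linarith

/-- An odd class contains a vertex that is unmatched, matched into `A`, or matched to another
class. -/
theorem card_oddLabels_le {V ι : Type*} [Fintype V] (A : Finset V) (c : V → ι) {p : V → V}
    (hp : ∀ v, p (p v) = v) :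
    (oddLabels A c).card ≤ (univ.filter (fun v => ¬ p v ≠ v)).card + A.card +
      ((univ.filter (fun v => v ∉ A ∧ p v ∉ A ∧ c (p v) ≠ c v)).image c).card := by
  have hsub : oddLabels A c ⊆ ((univ.filter (fun v => ¬ p v ≠ v)).image c ∪
      A.image (fun v => c (p v))) ∪
      (univ.filter (fun v => v ∉ A ∧ p v ∉ A ∧ c (p v) ≠ c v)).image c := by
    intro i hi
    by_contra hcon
    simp only [mem_union, mem_image, mem_filter, mem_univ, true_and, not_or, not_exists,
      not_and] at hcon
    obtain ⟨⟨h1, h2⟩, h3⟩ := hcon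
    have hne : ∀ v ∈ labelClass A c i, p v ≠ v := fun v hv h =>
      h1 v (not_not.2 h) (mem_labelClass.1 hv).2
    have hmem : ∀ v ∈ labelClass A c i, p v ∈ labelClass A c i := by
      intro v hv
      obtain ⟨hvA, hvi⟩ := mem_labelClass.1 hv
      have hpA : p v ∉ A := fun h => h2 _ h (by rw [hp, hvi])
      refine mem_labelClass.2 ⟨hpA, ?_⟩
      by_contra h
      exact h3 v ⟨hvA, hpA, by rwa [hvi]⟩ hvi
    have : ∑ v ∈ labelClass A c i, (1 : ZMod 2) = 0 :=
      sum_involution (fun v _ => p v) (fun _ _ => by decide) (fun v hv _ => hne v hv) hmem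
        (fun v _ => hp v)
    rw [sum_const, nsmul_one, ZMod.natCast_eq_zero_iff_even] at this
    exact Nat.not_even_iff_odd.2 (mem_oddLabels.1 hi) this
  refine (card_le_card hsub).trans ((card_union_le _ _).trans ?_)
  exact add_le_add ((card_union_le _ _).trans (add_le_add card_image_le card_image_le))
    le_rfl

/-- Few classes outside `A` have more than `1 / ε` vertices. -/
theorem card_image_large_le {V ι : Type*} [Fintype V] (A : Finset V) (c : V → ι) {ε : ℝ}
    (hε : 0 < ε) :
    (((univ.filter (fun v => v ∉ A ∧ 1 / ε < (labelClass A c (c v)).card)).image c).card : ℝ)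
      ≤ ε * Fintype.card V := by
  set L := univ.filter (fun v => v ∉ A ∧ 1 / ε < (labelClass A c (c v)).card) with hL
  have h1 : (L.card : ℝ) = ∑ i ∈ L.image c, ((L.filter (fun v => c v = i)).card : ℝ) := by
    exact_mod_cast card_eq_sum_card_fiberwise (fun v hv => mem_image_of_mem c hv)
  have h2 : (L.image c).card * (1 / ε) ≤ (L.card : ℝ) := by
    rw [h1, ← nsmul_eq_mul]
    refine card_nsmul_le_sum _ _ _ fun i hi => ?_
    obtain ⟨v, hv, rfl⟩ := mem_image.1 hi
    have hv' := (mem_filter.1 hv).2.2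
    refine hv'.le.trans (Nat.cast_le.2 (card_le_card fun w hw => ?_))
    obtain ⟨hwA, hwv⟩ := mem_labelClass.1 hw
    refine mem_filter.2 ⟨mem_filter.2 ⟨mem_univ _, hwA, ?_⟩, hwv⟩
    rwa [hwv]
  have h3 : (L.card : ℝ) ≤ Fintype.card V := by exact_mod_cast card_le_univ L
  have h4 := h2.trans h3
  rw [mul_one_div, div_le_iff₀ hε] at h4
  linarith

/-- If every edge of `E` outside `F ⊇ H` has large edge degree in the edge-degree-bounded subgraph
`H`, then `F` contains a matching of nearly two thirds of the maximum size. -/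
theorem matchNum_le_of_degE {V : Type*} [Fintype V] {E H F : Finset (Sym2 V)} {ε β : ℝ}
    (hε : 0 < ε) (hε' : ε < 1 / 2) (hβ : 2 / ε ^ 2 ≤ β) (hHF : H ⊆ F)
    (hH : ∀ e ∈ H, (degE H e : ℝ) ≤ β)
    (hF : ∀ e ∈ E, e ∉ F → (1 - ε) * β ≤ degE H e) :
    (matchNum E : ℝ) ≤ 3 / 2 * matchNum F + 3 * ε * Fintype.card V := by
  obtain ⟨M, hME, hM, hMcard⟩ := exists_isMatching_card_eq_matchNum E
  obtain ⟨p, hp, hpM, hpcard⟩ := hM.exists_involution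
  obtain ⟨A, ι, c, hc, hTB⟩ := exists_labels_card_add_card_le F
  have hodd := card_oddLabels_le A c hp
  set X := univ.filter (fun v => v ∉ A ∧ p v ∉ A ∧ c (p v) ≠ c v) with hX
  set L := univ.filter (fun v => v ∉ A ∧ 1 / ε < (labelClass A c (c v)).card) with hL
  have hLim : ((L.image c).card : ℝ) ≤ ε * Fintype.card V := card_image_large_le A c hε
  have hfix := card_filter_add_card_filter_not (s := (univ : Finset V)) (fun v => p v ≠ v)
  rw [card_univ] at hfix
  have hAL : Disjoint A L := disjoint_left.2 fun v hv hvL => (mem_filter.1 hvL).2.1 hv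
  have hALn : A.card + L.card ≤ Fintype.card V := by
    rw [← card_union_of_disjoint hAL]
    exact card_le_univ _
  -- the matching number of `F` in terms of `A` and `L`
  have hmuF : (oddLabels A c).card + A.card + L.card ≤ Fintype.card V + (L.image c).card := by
    have hsub : oddLabels A c ⊆ (univ \ (A ∪ L)).image c ∪ L.image c := by
      intro i hi
      obtain ⟨v, hv⟩ := card_pos.1 (mem_oddLabels.1 hi).pos
      obtain ⟨hvA, rfl⟩ := mem_labelClass.1 hv
      by_cases hvL : v ∈ L
      · exact mem_union_right _ (mem_image_of_mem c hvL)
      · exact mem_union_left _ (mem_image_of_mem c (by simp [hvA, hvL]))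
    have h1 := (card_le_card hsub).trans (card_union_le _ _)
    have h2 : ((univ \ (A ∪ L)).image c).card ≤ _ := card_image_le
    have h3 := card_sdiff_add_card_eq_card (subset_univ (A ∪ L))
    rw [card_univ, card_union_of_disjoint hAL] at h3
    omega
  -- the cross vertices in small classes
  set S₁ := X.filter (fun v => v ∉ L ∧ p v ∉ L) with hS₁
  set S₂ := X.filter (fun v => v ∉ L ∧ p v ∈ L) with hS₂
  have hXim : (X.image c).card ≤ S₁.card + S₂.card + (L.image c).card := by
    have hsub : X.image c ⊆ (S₁ ∪ S₂).image c ∪ L.image c := by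
      intro i hi
      obtain ⟨v, hv, rfl⟩ := mem_image.1 hi
      by_cases hvL : v ∈ L
      · exact mem_union_right _ (mem_image_of_mem c hvL)
      · refine mem_union_left _ (mem_image_of_mem c ?_)
        by_cases hpL : p v ∈ L <;> simp [hS₁, hS₂, hv, hvL, hpL]
    have h1 := (card_le_card hsub).trans (card_union_le _ _)
    have h2 : ((S₁ ∪ S₂).image c).card ≤ _ := card_image_le
    have h3 := card_union_le S₁ S₂
    omega
  have hXp : ∀ v ∈ X, p v ∈ X := by
    intro v hv
    obtain ⟨h1, h2, h3⟩ := (mem_filter.1 hv).2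
    exact mem_filter.2 ⟨mem_univ _, h2, by rwa [hp], by rw [hp]; exact h3.symm⟩
  have hXdeg : ∀ v ∈ X, (1 - ε) * β ≤ degV H v + degV H (p v) := by
    intro v hv
    obtain ⟨h1, h2, h3⟩ := (mem_filter.1 hv).2
    have h4 := hF s(v, p v) (hME (hpM v fun h => h3 (by rw [h])))
      (fun h => h3 (hc v _ h1 h2 h).symm)
    have h5 : degE H s(v, p v) = degV H v + degV H (p v) := rfl
    rw [h5] at h4
    exact_mod_cast h4
  have hnbr : ∀ (T : Finset V) (v : V), v ∈ X → v ∉ L → A ⊆ T →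
      (degV H v : ℝ) ≤ (T.filter (fun t => s(v, t) ∈ H)).card + 1 / ε := by
    intro T v hv hvL hAT
    have hvA := (mem_filter.1 hv).2.1
    have hsub : univ.filter (fun w => s(v, w) ∈ H) ⊆
        T.filter (fun t => s(v, t) ∈ H) ∪ labelClass A c (c v) := by
      intro w hw
      have hw := (mem_filter.1 hw).2
      by_cases hwA : w ∈ A
      · exact mem_union_left _ (mem_filter.2 ⟨hAT hwA, hw⟩)
      · exact mem_union_right _ (mem_labelClass.2 ⟨hwA, (hc v w hvA hwA (hHF hw)).symm⟩)
    have h1 := (card_le_card hsub).trans (card_union_le _ _)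
    rw [← degV_eq_card_neighbors] at h1
    have h2 : ((labelClass A c (c v)).card : ℝ) ≤ 1 / ε := by
      by_contra h
      exact hvL (mem_filter.2 ⟨mem_univ _, hvA, not_le.1 h⟩)
    have h3 : (degV H v : ℝ) ≤ (T.filter (fun t => s(v, t) ∈ H)).card
        + (labelClass A c (c v)).card := by exact_mod_cast h1
    linarith
  have hnbrL : ∀ v ∈ L, (degV H v : ℝ) ≤ ((A ∪ L).filter (fun t => s(v, t) ∈ H)).card + 1 / ε := by
    intro v hv
    obtain ⟨hvA, hvL⟩ := (mem_filter.1 hv).2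
    have hsub : univ.filter (fun w => s(v, w) ∈ H) ⊆ (A ∪ L).filter (fun t => s(v, t) ∈ H) := by
      intro w hw
      have hw := (mem_filter.1 hw).2
      refine mem_filter.2 ⟨?_, hw⟩
      by_cases hwA : w ∈ A
      · exact mem_union_left _ hwA
      · refine mem_union_right _ (mem_filter.2 ⟨mem_univ _, hwA, ?_⟩)
        rwa [← hc v w hvA hwA (hHF hw)]
    have h1 := card_le_card hsub
    rw [← degV_eq_card_neighbors] at h1
    have h2 : (degV H v : ℝ) ≤ ((A ∪ L).filter (fun t => s(v, t) ∈ H)).card := by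
      exact_mod_cast h1
    have : 0 < 1 / ε := by positivity
    linarith
  have hbound : ∀ S T : Finset V,
      (S.card : ℝ) ≤ T.card + 2 * ε * (S.card + T.card) →
      (S.card : ℝ) ≤ T.card + 4 * ε * Fintype.card V := by
    intro S T h
    have h1 : (S.card : ℝ) ≤ Fintype.card V := by exact_mod_cast card_le_univ S
    have h2 : (T.card : ℝ) ≤ Fintype.card V := by exact_mod_cast card_le_univ T
    have h3 : 2 * ε * (S.card + T.card) ≤ 2 * ε * (Fintype.card V + Fintype.card V : ℝ) := by
      gcongr
    linarith
  have hcross : (S₁.card : ℝ) + S₂.card ≤ A.card + L.card / 2 + 4 * ε * Fintype.card V := by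
    rcases le_total ((S₂.card : ℝ)) (L.card / 2) with hcase | hcase
    · have h := hbound S₁ A (card_le_card_add_of_degE_le hε hε' hβ hH (p := p) ?_ hp ?_ ?_)
      · linarith
      · intro v hv
        obtain ⟨hv, hvL, hpL⟩ := mem_filter.1 hv
        exact mem_filter.2 ⟨hXp v hv, hpL, by rwa [hp]⟩
      · exact fun v hv => hXdeg v (mem_filter.1 hv).1
      · intro v hv
        obtain ⟨hv, hvL, hpL⟩ := mem_filter.1 hv
        exact hnbr A v hv hvL subset_rfl
    · have hinj : (S₂.image p).card = S₂.card :=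
        card_image_of_injective _ (Function.LeftInverse.injective hp)
      have hpL : ∀ v ∈ S₂.image p, v ∈ X ∧ v ∈ L := by
        intro v hv
        obtain ⟨w, hw, rfl⟩ := mem_image.1 hv
        obtain ⟨hw, -, hpL⟩ := mem_filter.1 hw
        exact ⟨hXp w hw, hpL⟩
      have hSX : ∀ v ∈ (S₁ ∪ S₂) ∪ S₂.image p, v ∈ X := by
        intro v hv
        rcases mem_union.1 hv with hv | hv
        · rcases mem_union.1 hv with hv | hv <;> exact (mem_filter.1 hv).1
        · exact (hpL v hv).1
      have hcard : ((S₁ ∪ S₂) ∪ S₂.image p).card = S₁.card + S₂.card + S₂.card := by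
        rw [card_union_of_disjoint, card_union_of_disjoint, hinj]
        · exact disjoint_left.2 fun v h1 h2 => (mem_filter.1 h1).2.2 (mem_filter.1 h2).2.2
        · refine disjoint_left.2 fun v h1 h2 => ?_
          rcases mem_union.1 h1 with h1 | h1 <;> exact (mem_filter.1 h1).2.1 (hpL v h2).2
      have h := hbound ((S₁ ∪ S₂) ∪ S₂.image p) (A ∪ L)
        (card_le_card_add_of_degE_le hε hε' hβ hH (p := p) ?_ hp ?_ ?_)
      · rw [hcard, card_union_of_disjoint hAL] at h
        push_cast at h
        linarith
      · intro v hv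
        rcases mem_union.1 hv with hv | hv
        · refine mem_union.2 ?_
          rcases mem_union.1 hv with hv | hv
          · obtain ⟨hv, hvL, hpL⟩ := mem_filter.1 hv
            exact .inl (mem_union_left _ (mem_filter.2 ⟨hXp v hv, hpL, by rwa [hp]⟩))
          · exact .inr (mem_image_of_mem p hv)
        · obtain ⟨w, hw, rfl⟩ := mem_image.1 hv
          rw [hp]
          exact mem_union_left _ (mem_union_right _ hw)
      · exact fun v hv => hXdeg v (hSX v hv)
      · intro v hv
        by_cases hvL : v ∈ L
        · exact hnbrL v hvL
        · exact hnbr _ v (hSX v hv) hvL subset_union_left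
  have g1 : (Fintype.card V : ℝ) + A.card ≤ 2 * matchNum F + (oddLabels A c).card := by
    exact_mod_cast hTB
  have g2 : ((oddLabels A c).card : ℝ) + A.card + L.card ≤ Fintype.card V + (L.image c).card := by
    exact_mod_cast hmuF
  have g3 : ((X.image c).card : ℝ) ≤ S₁.card + S₂.card + (L.image c).card := by
    exact_mod_cast hXim
  have g4 : 2 * matchNum E ≤ 2 * matchNum F + (X.image c).card := by omega
  have g5 : 2 * (matchNum E : ℝ) ≤ 2 * matchNum F + (X.image c).card := by exact_mod_cast g4
  have g6 : 0 ≤ ε * Fintype.card V := by positivity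
  linarith

/-- Markov's inequality for degrees. -/
theorem card_mul_le_of_le_degV {V : Type*} [Fintype V] {F : Finset (Sym2 V)}
    (hF : ∀ e ∈ F, ¬ e.IsDiag) {B : Finset V} {x : ℝ} (hB : ∀ v ∈ B, x ≤ degV F v) :
    B.card * x ≤ 2 * F.card := by
  calc (B.card : ℝ) * x = ∑ v ∈ B, x := by simp
    _ ≤ ∑ v ∈ B, (degV F v : ℝ) := sum_le_sum hB
    _ ≤ ∑ v, (degV F v : ℝ) := sum_le_univ_sum_of_nonneg fun v => by positivity
    _ = 2 * F.card := by exact_mod_cast sum_degV hF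

/-- Few vertices are discarded by pruning at degree `d / ε` and then at degree
`(1 - ε) * d ^ γ / ε` in a set of at most `n * d ^ γ` edges. -/
theorem card_sdiff_small_le {V : Type*} [Fintype V] {E Ustar : Finset (Sym2 V)}
    {Vstar Vsmall : Finset V} {ε d γ : ℝ} (hE : ∀ e ∈ E, ¬ e.IsDiag) (hd0 : 0 < d)
    (hn : (0 : ℝ) < Fintype.card V) (hε0 : 0 < ε) (hε1 : ε < 1 / 2)
    (hd : d = 2 * E.card / Fintype.card V)
    (hVstar : Vstar = univ.filter (fun v => (degV E v : ℝ) ≤ d / ε)) (hUE : Ustar ⊆ E)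
    (hUcard : (Ustar.card : ℝ) ≤ Fintype.card V * d ^ γ)
    (hVsmall : ∀ v ∈ Vstar, (degV Ustar v : ℝ) ≤ (1 - ε) * d ^ γ / ε → v ∈ Vsmall) :
    ((univ \ Vsmall).card : ℝ) ≤ 5 * ε * Fintype.card V := by
  have hB1 : ((univ \ Vstar).card : ℝ) ≤ ε * Fintype.card V := by
    have h1 := card_mul_le_of_le_degV hE (B := univ \ Vstar) (x := d / ε) (by
      intro v hv
      by_contra h
      exact (mem_sdiff.1 hv).2 (by rw [hVstar]; exact mem_filter.2 ⟨mem_univ _, (not_le.1 h).le⟩))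
    have h2 : 2 * (E.card : ℝ) = d * Fintype.card V := by rw [hd]; field_simp
    rw [h2, mul_div_assoc', div_le_iff₀ hε0] at h1
    refine le_of_mul_le_mul_left ?_ hd0
    linarith
  have hB2 : ((Vstar \ Vsmall).card : ℝ) ≤ 4 * ε * Fintype.card V := by
    have hpow : 0 < d ^ γ := Real.rpow_pos_of_pos hd0 γ
    have h1 := card_mul_le_of_le_degV (F := Ustar) (B := Vstar \ Vsmall)
      (x := (1 - ε) * d ^ γ / ε)
      (fun e he => hE e (hUE he)) (by
        intro v hv
        by_contra h
        obtain ⟨hv1, hv2⟩ := mem_sdiff.1 hv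
        exact hv2 (hVsmall v hv1 (not_le.1 h).le))
    rw [mul_div_assoc', div_le_iff₀ hε0] at h1
    have h2 : (Ustar.card : ℝ) * ε ≤ Fintype.card V * d ^ γ * ε := by gcongr
    have h3 : ((Vstar \ Vsmall).card : ℝ) * (1 / 2 * d ^ γ)
        ≤ (Vstar \ Vsmall).card * ((1 - ε) * d ^ γ) := by
      gcongr
      linarith
    refine le_of_mul_le_mul_left ?_ hpow
    linarith
  have hB : (univ \ Vsmall).card ≤ (univ \ Vstar).card + (Vstar \ Vsmall).card := by
    refine (card_le_card ?_).trans (card_union_le _ _)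
    intro v hv
    by_cases h : v ∈ Vstar
    · exact mem_union_right _ (mem_sdiff.2 ⟨h, (mem_sdiff.1 hv).2⟩)
    · exact mem_union_left _ (mem_sdiff.2 ⟨mem_univ v, h⟩)
  have hB' : ((univ \ Vsmall).card : ℝ) ≤ (univ \ Vstar).card + (Vstar \ Vsmall).card := by
    exact_mod_cast hB
  linarith

/-- pruning high-degree vertices (degree > d/ε) and then the vertices of
large U*-degree still preserves μ(G) ≤ (3/2 + ε)·μ(E*_small) + C'·ε·n. -/
theorem prune_high_degree_approx :
    ∃ C C' : ℝ, 0 < C ∧ 0 < C' ∧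
      ∀ (V : Type) [Fintype V] (ε β γ : ℝ), ε ∈ Set.Ioo (0 : ℝ) (1/2) →
        C / ε ^ 3 ≤ β → 0 < γ →
        ∀ (E H U : Finset (Sym2 V)), (∀ e ∈ E, ¬ e.IsDiag) → H ⊆ E →
          (∀ e ∈ H, (degE H e : ℝ) ≤ β) →
          U = E.filter (fun e => e ∉ H ∧ (degE H e : ℝ) < (1 - ε) * β) →
          ∀ d : ℝ, d = 2 * E.card / Fintype.card V →
          ∀ Vstar : Finset V, Vstar = Finset.univ.filter (fun v => (degV E v : ℝ) ≤ d / ε) →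
          ∀ Estar : Finset (Sym2 V), Estar = E.filter (fun e => ∀ v ∈ e, v ∈ Vstar) →
          ∀ Hstar Ustar : Finset (Sym2 V), Hstar = H ∩ Estar → Ustar = U ∩ Estar →
          (Ustar.card : ℝ) ≤ Fintype.card V * d ^ γ →
          ∀ Vsmall : Finset V, Vsmall ⊆ Vstar →
            (∀ v ∈ Vstar, (degV Ustar v : ℝ) ≤ (1 - ε) * d ^ γ / ε → v ∈ Vsmall) →
          ∀ Esmall : Finset (Sym2 V),
            Esmall = (Hstar ∪ Ustar).filter (fun e => ∀ v ∈ e, v ∈ Vsmall) →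
          (matchNum E : ℝ) ≤ (3/2 + ε) * matchNum Esmall + C' * ε * Fintype.card V := by
  refine ⟨1, 11, one_pos, by norm_num, ?_⟩
  intro V _ ε β γ hε hβ _ E H U hE hHE hH hU d hd Vstar hVstar Estar hEstar Hstar Ustar hHstar
    hUstar hUcard Vsmall hVsub hVsmall Esmall hEsmall
  obtain ⟨hε0, hε1⟩ := hε
  rcases E.eq_empty_or_nonempty with rfl | hne
  · have h0 : matchNum (∅ : Finset (Sym2 V)) = 0 := by simp [matchNum]
    rw [h0, Nat.cast_zero]
    positivity
  have hEpos : (0 : ℝ) < E.card := by exact_mod_cast hne.card_pos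
  have hn : (0 : ℝ) < Fintype.card V := by
    obtain ⟨e, -⟩ := hne
    induction e with
    | h a b => exact_mod_cast Fintype.card_pos_iff.2 ⟨a⟩
  have hd0 : 0 < d := by rw [hd]; positivity
  have hβ2 : 2 / ε ^ 2 ≤ β := by
    refine le_trans ?_ hβ
    rw [div_le_div_iff₀ (by positivity) (by positivity)]
    have : ε ^ 2 * (2 * ε) ≤ ε ^ 2 * 1 := by gcongr; linarith
    linarith
  have hcore := matchNum_le_of_degE (E := E) (F := H ∪ U) hε0 hε1 hβ2 subset_union_left hH (by
    intro e he hnot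
    by_contra hlt
    rw [mem_union, not_or] at hnot
    refine hnot.2 ?_
    rw [hU]
    exact mem_filter.2 ⟨he, hnot.1, not_le.1 hlt⟩)
  have hUE : U ⊆ E := hU ▸ filter_subset _ _
  have hdel : matchNum (H ∪ U) ≤ matchNum Esmall + (univ \ Vsmall).card := by
    refine matchNum_le_matchNum_add_card fun e heHU hev => ?_
    have hev' : ∀ v ∈ e, v ∈ Vsmall := fun v hv => by simpa using hev v hv
    have heE : e ∈ Estar := by
      rw [hEstar]
      exact mem_filter.2 ⟨union_subset hHE hUE heHU, fun v hv => hVsub (hev' v hv)⟩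
    rw [hEsmall, hHstar, hUstar, ← union_inter_distrib_right]
    exact mem_filter.2 ⟨mem_inter.2 ⟨heHU, heE⟩, hev'⟩
  have hB := card_sdiff_small_le hE hd0 hn hε0 hε1 hd hVstar
    (hUstar ▸ inter_subset_right.trans (hEstar ▸ filter_subset _ _)) hUcard hVsmall
  have hdel' : (matchNum (H ∪ U) : ℝ) ≤ matchNum Esmall + (univ \ Vsmall).card := by
    exact_mod_cast hdel
  have h1 : 0 ≤ ε * matchNum Esmall := by positivity
  have h2 : 0 ≤ ε * Fintype.card V := by positivity
  linarith only [hcore, hdel', hB, h1, h2]
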